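/- Let ω ∈ T2.1, i.e., ω is a factor of F_∞ with f_k < n < f_{k+1} (n = |ω|) and sk(ω) = s_k. Then in the unique kernel decomposition ω = μ₁ s_k μ₂, there exists i with 0 ≤ i ≤ n − f_k such that μ₁ is the suffix of s_{k-1} of length i (μ₁ = s_{k-1}[f_{k-1}−i+1, f_{k-1}]) and μ₂ is the prefix of s_{k-1} of length n − f_k − i (μ₂ = s_{k-1}[1, n−f_k−i]). -/

import Mathlib

/-- Finite Fibonacci words: `Fw k = σ^k(a)` where `a = false`, `b = true`,
`σ(a) = ab`, `σ(b) = a`; so `Fw (k+2) = Fw (k+1) ++ Fw k`. -/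
def Fw : ℕ → List Bool
  | 0 => [false]
  | 1 => [false, true]
  | (k+2) => Fw (k+1) ++ Fw k

/-- The infinite Fibonacci word `F_∞` (0-indexed): since `Fw (n+1)` has length
`fib (n+3) > n`, its `n`-th letter is the `n`-th letter of `F_∞`. -/
def fw (n : ℕ) : Bool := (Fw (n+1)).getD n false

/-- Singular words, with index shifted by one: `sw n = s_{n-1}`.
`sw 0 = s_{-1} = a`, and `sw (n+1) = s_n = β_n · F_n · α_n⁻¹` where
`α_n` is the last letter of `F_n` and `β_n` the other letter. -/
def sw : ℕ → List Bool
  | 0 => [false]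
  | (n+1) => (!((Fw n).getLastD false)) :: (Fw n).dropLast

/-- The factor of `F_∞` of length `n` starting at (0-indexed) position `i`. -/
def seg (i n : ℕ) : List Bool := (List.range n).map (fun t => fw (i + t))

/-- `w` occurs in `F_∞` at (0-indexed) position `i`. -/
def OccursAt (w : List Bool) (i : ℕ) : Prop := seg i w.length = w

/-- `w` is a factor of `F_∞`. -/
def IsFactor (w : List Bool) : Prop := ∃ i, OccursAt w i

/-- Starting position of the `(p+1)`-st occurrence of `w` in `F_∞`
(occurrences enumerated by starting position, 0-indexed: `occPos w 0`
is the first occurrence, i.e. the paper's `ω_1`). -/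
noncomputable def occPos (w : List Bool) (p : ℕ) : ℕ := Nat.nth (OccursAt w) p

/-- A finite word viewed as an element of the free group on the alphabet. -/
def listToFree (w : List Bool) : FreeGroup Bool := (w.map FreeGroup.of).prod

/-- The gap `ν_{w,p}` (0-indexed in `p`: `gap w 0` is the paper's `ν_{w,1}`)
between the `(p+1)`-st and `(p+2)`-nd occurrences of `w`, as an element of the
free group: the separating word if the occurrences are separated or adjacent,
and the formal inverse of the overlap if they overlap. -/
noncomputable def gap (w : List Bool) (p : ℕ) : FreeGroup Bool :=
  if occPos w p + w.length ≤ occPos w (p+1) then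
    listToFree (seg (occPos w p + w.length) (occPos w (p+1) - (occPos w p + w.length)))
  else
    (listToFree (seg (occPos w (p+1)) (occPos w p + w.length - occPos w (p+1))))⁻¹

/-- The signed length `|ν_{w,p}|` of the gap (negative in the overlapped case). -/
noncomputable def gapLen (w : List Bool) (p : ℕ) : ℤ :=
  (occPos w (p+1) : ℤ) - ((occPos w p : ℤ) + (w.length : ℤ))

/-- `u` is a singular word (some `s_k`, `k ≥ -1`). -/
def IsSingular (u : List Bool) : Prop := ∃ n, u = sw n

/-- `u` is a singular kernel of `w`: a singular factor of `w` of maximal length. -/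
def IsKernelOf (u w : List Bool) : Prop :=
  IsSingular u ∧ u <:+: w ∧ ∀ v : List Bool, IsSingular v → v <:+: w → v.length ≤ u.length

/-- The excluded words `{ε, ab, ba, aba}`. -/
def excl : List (List Bool) := [[], [false, true], [true, false], [false, true, false]]

/-- The `i`-th conjugate `C_i(w)` (indices taken mod the length). -/
def conj (i : ℕ) (w : List Bool) : List Bool :=
  w.drop (i % w.length) ++ w.take (i % w.length)

/-- `sliceW u i j = u[i,j]`, the letters `i` through `j` of `u`, 1-indexed. -/
def sliceW (u : List Bool) (i j : ℕ) : List Bool := (u.take j).drop (i - 1)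

/-- The Fibonacci morphism `a ↦ ab`, `b ↦ a` on finite words. -/
def fibMorph : List Bool → List Bool
  | [] => []
  | false :: w => false :: true :: fibMorph w
  | true :: w => false :: fibMorph w

theorem fibMorph_append (u v : List Bool) : fibMorph (u ++ v) = fibMorph u ++ fibMorph v := by
  induction u with
  | nil => rfl
  | cons x u ih => cases x <;> simp [fibMorph, ih]

theorem fibMorph_Fw (k : ℕ) : fibMorph (Fw k) = Fw (k + 1) := by
  induction k using Nat.twoStepInduction with
  | zero => rfl
  | one => rfl
  | more k ih₁ ih₂ =>
    rw [show Fw (k + 2) = Fw (k + 1) ++ Fw k from rfl, fibMorph_append, ih₁, ih₂]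
    rfl

theorem length_Fw (k : ℕ) : (Fw k).length = Nat.fib (k + 2) := by
  induction k using Nat.twoStepInduction with
  | zero => rfl
  | one => rfl
  | more k ih₁ ih₂ =>
    rw [show Fw (k + 2) = Fw (k + 1) ++ Fw k from rfl, List.length_append, ih₁, ih₂,
      Nat.fib_add_two (n := k + 2), add_comm]

theorem Fw_prefix_succ (k : ℕ) : Fw k <+: Fw (k + 1) := by
  cases k with
  | zero => exact ⟨[true], rfl⟩
  | succ k => exact List.prefix_append _ _

theorem Fw_prefix_of_le {m n : ℕ} (h : m ≤ n) : Fw m <+: Fw n := by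
  induction n, h using Nat.le_induction with
  | base => exact List.prefix_rfl
  | succ n _ ih => exact ih.trans (Fw_prefix_succ n)

theorem lt_length_Fw (n : ℕ) : n < (Fw n).length := by
  rw [length_Fw]
  have := Nat.le_fib_add_one (n + 2)
  omega

theorem occursAt_nil (i : ℕ) : OccursAt [] i := rfl

theorem occursAt_cons (x : Bool) (w : List Bool) (i : ℕ) :
    OccursAt (x :: w) i ↔ fw i = x ∧ OccursAt w (i + 1) := by
  simp [OccursAt, seg, List.range_succ_eq_map, Function.comp_def, add_assoc, add_comm 1]

theorem occursAt_append (u v : List Bool) (i : ℕ) :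
    OccursAt (u ++ v) i ↔ OccursAt u i ∧ OccursAt v (i + u.length) := by
  induction u generalizing i with
  | nil => simp [occursAt_nil]
  | cons x u ih =>
    simp [occursAt_cons, ih, and_assoc, add_assoc, add_comm 1]

theorem occursAt_seg (i n : ℕ) : OccursAt (seg i n) i := by
  simp [OccursAt, seg]

theorem occursAt_Fw_zero (N : ℕ) : OccursAt (Fw N) 0 := by
  refine List.ext_getElem (by simp [seg]) fun n h₁ h₂ => ?_
  simp only [seg, List.getElem_map, List.getElem_range, zero_add, fw]
  have h₃ : n < (Fw (n + 1)).length := (Nat.lt_succ_self n).trans (lt_length_Fw (n + 1))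
  rw [List.getD_eq_getElem _ _ h₃]
  rcases le_total N (n + 1) with h | h
  · exact ((Fw_prefix_of_le h).getElem h₂).symm
  · exact (Fw_prefix_of_le h).getElem h₃

theorem OccursAt.prefix_of_length_le {u v : List Bool} {i : ℕ} (hu : OccursAt u i)
    (hv : OccursAt v i)
    (h : u.length ≤ v.length) : u <+: v := by
  induction u generalizing v i with
  | nil => exact ⟨v, rfl⟩
  | cons x u ih =>
    cases v with
    | nil => simp at h
    | cons y v =>
      rw [occursAt_cons] at hu hv
      rw [← hu.1, ← hv.1, List.cons_prefix_cons]
      exact ⟨rfl, ih hu.2 hv.2 (by simpa using h)⟩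

theorem OccursAt.suffix_of_length_le {u v : List Bool} {i j : ℕ} (hu : OccursAt u i)
    (hv : OccursAt v j)
    (hij : i + u.length = j + v.length) (h : u.length ≤ v.length) : u <:+ v := by
  rw [← List.take_append_drop (v.length - u.length) v, occursAt_append] at hv
  have hi : j + (v.take (v.length - u.length)).length = i := by
    rw [List.length_take]; omega
  have hp := hu.prefix_of_length_le (hi ▸ hv.2) (by rw [List.length_drop]; omega)
  rw [hp.eq_of_length (by rw [List.length_drop]; omega)]
  exact List.drop_suffix _ _

/-- The position in `F_∞` at which the image of its `q`-th letter starts. -/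
def cut (q : ℕ) : ℕ := (fibMorph (seg 0 q)).length

theorem seg_zero_succ (q : ℕ) : seg 0 (q + 1) = seg 0 q ++ [fw q] := by
  simp [seg, List.range_succ]

theorem cut_succ (q : ℕ) : cut (q + 1) = cut q + (fibMorph [fw q]).length := by
  rw [cut, seg_zero_succ, fibMorph_append, List.length_append, cut]

theorem occursAt_fibMorph_letter (q : ℕ) : OccursAt (fibMorph [fw q]) (cut q) := by
  have hp : seg 0 (q + 1) <+: Fw (q + 1) :=
    (occursAt_seg 0 (q + 1)).prefix_of_length_le (occursAt_Fw_zero _)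
      (by simpa [seg] using (lt_length_Fw (q + 1)).le)
  obtain ⟨v, hv⟩ := hp
  have h := occursAt_Fw_zero (q + 2)
  rw [← fibMorph_Fw (q + 1), ← hv, seg_zero_succ, fibMorph_append, fibMorph_append,
    occursAt_append, occursAt_append, zero_add] at h
  exact h.1.2

theorem fw_cut (q : ℕ) : fw (cut q) = false := by
  have h := occursAt_fibMorph_letter q
  cases hq : fw q <;> rw [hq, fibMorph, occursAt_cons] at h <;> exact h.1

theorem fw_cut_add_one {q : ℕ} (hq : fw q = false) : fw (cut q + 1) = true := by
  have h := occursAt_fibMorph_letter q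
  rw [hq, fibMorph, occursAt_cons, occursAt_cons] at h
  exact h.2.1

theorem cut_succ_of_false {q : ℕ} (hq : fw q = false) : cut (q + 1) = cut q + 2 := by
  rw [cut_succ, hq]; rfl

theorem cut_succ_of_true {q : ℕ} (hq : fw q = true) : cut (q + 1) = cut q + 1 := by
  rw [cut_succ, hq]; rfl

theorem eq_cut_or (p : ℕ) : ∃ q, p = cut q ∨ (p = cut q + 1 ∧ fw q = false) := by
  induction p with
  | zero => exact ⟨0, Or.inl rfl⟩
  | succ p ih =>
    obtain ⟨q, rfl | ⟨rfl, hq⟩⟩ := ih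
    · cases hq : fw q
      · exact ⟨q, Or.inr ⟨rfl, hq⟩⟩
      · exact ⟨q + 1, Or.inl (cut_succ_of_true hq).symm⟩
    · exact ⟨q + 1, Or.inl (cut_succ_of_false hq).symm⟩

theorem exists_cut_of_false {p : ℕ} (hp : fw p = false) : ∃ q, p = cut q := by
  obtain ⟨q, h | ⟨rfl, hq⟩⟩ := eq_cut_or p
  · exact ⟨q, h⟩
  · simp [fw_cut_add_one hq] at hp

theorem exists_cut_of_true {p : ℕ} (hp : fw p = true) : ∃ q, p = cut q + 1 ∧ fw q = false := by
  obtain ⟨q, rfl | h⟩ := eq_cut_or p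
  · simp [fw_cut] at hp
  · exact ⟨q, h⟩

theorem fw_succ_of_true {p : ℕ} (hp : fw p = true) : fw (p + 1) = false := by
  obtain ⟨q, rfl, hq⟩ := exists_cut_of_true hp
  rw [add_assoc, ← cut_succ_of_false hq, fw_cut]

theorem cut_add_length {w : List Bool} {q : ℕ} (h : OccursAt w q) :
    cut (q + w.length) = cut q + (fibMorph w).length := by
  induction w generalizing q with
  | nil => rfl
  | cons x w ih =>
    rw [occursAt_cons] at h
    have := ih h.2
    rw [List.length_cons, show q + (w.length + 1) = q + 1 + w.length by omega, this]
    cases x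
    · rw [cut_succ_of_false h.1, fibMorph, List.length_cons, List.length_cons]; omega
    · rw [cut_succ_of_true h.1, fibMorph, List.length_cons]; omega

/-- Unique desubstitution: the trailing `a` marks the end of the last block. -/
theorem occursAt_fibMorph_iff (w : List Bool) (q : ℕ) :
    OccursAt (fibMorph w ++ [false]) (cut q) ↔ OccursAt w q := by
  induction w generalizing q with
  | nil => simp [fibMorph, occursAt_cons, occursAt_nil, fw_cut]
  | cons x w ih =>
    cases x
    · rw [occursAt_cons, fibMorph, List.cons_append, List.cons_append, occursAt_cons,
        occursAt_cons]
      cases hq : fw q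
      · simp [fw_cut, fw_cut_add_one hq, ← ih, cut_succ_of_false hq, add_assoc]
      · simp [← cut_succ_of_true hq, fw_cut]
    · rw [occursAt_cons, fibMorph, List.cons_append, occursAt_cons]
      cases hq : fw q
      · have hne : ¬ OccursAt (fibMorph w ++ [false]) (cut q + 1) := by
          have := fw_cut_add_one hq
          rcases w with _ | ⟨_ | _, w⟩ <;> simp [fibMorph, occursAt_cons, this]
        simp [hne]
      · simp [fw_cut, ← ih, cut_succ_of_true hq]

theorem sw_succ_eq_of_parity (k : ℕ) :
    (Even k → ∃ g, Fw k = g ++ [false] ∧ sw (k + 1) = true :: g) ∧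
    (Odd k → ∃ g, Fw k = g ++ [true] ∧ sw (k + 1) = false :: g) := by
  have key : ∀ g x, Fw k = g ++ [x] → sw (k + 1) = (!x) :: g := by
    intro g x h
    simp [sw, h]
  suffices h : (Even k → ∃ g, Fw k = g ++ [false]) ∧ (Odd k → ∃ g, Fw k = g ++ [true]) from
    ⟨fun hk => (h.1 hk).imp fun g hg => ⟨hg, key g _ hg⟩,
      fun hk => (h.2 hk).imp fun g hg => ⟨hg, key g _ hg⟩⟩
  clear key
  induction k with
  | zero => exact ⟨fun _ => ⟨[], rfl⟩, fun h => by simp at h⟩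
  | succ k ih =>
    constructor
    · intro hk
      obtain ⟨g, hg⟩ := ih.2 (by grind)
      exact ⟨fibMorph g, by rw [← fibMorph_Fw, hg, fibMorph_append]; rfl⟩
    · intro hk
      obtain ⟨g, hg⟩ := ih.1 (by grind)
      exact ⟨fibMorph g ++ [false], by rw [← fibMorph_Fw, hg, fibMorph_append]; simp [fibMorph]⟩

theorem fibMorph_sw_of_even {k : ℕ} (hk : Even k) :
    fibMorph (sw k) = false :: sw (k + 1) := by
  cases k with
  | zero => rfl
  | succ k =>
    obtain ⟨g, hg, hs⟩ := (sw_succ_eq_of_parity k).2 (by grind)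
    have hF : Fw (k + 1) = fibMorph g ++ [false] := by
      rw [← fibMorph_Fw, hg, fibMorph_append]; rfl
    rw [hs]
    simp [sw, hF, fibMorph]

theorem sw_succ_of_odd {k : ℕ} (hk : Odd k) : sw (k + 1) = fibMorph (sw k) ++ [false] := by
  cases k with
  | zero => simp at hk
  | succ k =>
    obtain ⟨g, hg, hs⟩ := (sw_succ_eq_of_parity k).1 (by grind)
    have hF : Fw (k + 1) = (fibMorph g ++ [false]) ++ [true] := by
      rw [← fibMorph_Fw, hg, fibMorph_append]; simp [fibMorph]
    rw [hs]
    simp only [sw, hF, List.dropLast_concat, List.getLastD_concat, fibMorph]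
    rfl

theorem exists_sw_eq_concat_of_even {k : ℕ} (hk : Even k) : ∃ g, sw k = g ++ [false] := by
  cases k with
  | zero => exact ⟨[], rfl⟩
  | succ k => exact ⟨_, sw_succ_of_odd (by grind)⟩

theorem length_sw (k : ℕ) : (sw k).length = Nat.fib (k + 1) := by
  cases k with
  | zero => rfl
  | succ k =>
    have := lt_length_Fw k
    simp only [sw, List.length_cons, List.length_dropLast]
    rw [← length_Fw]; omega

/-- Every occurrence of `s_k` in `F_∞` is immediately preceded and followed by `s_{k-1}`. -/
theorem occursAt_sw_neighbours (k p : ℕ) (h : OccursAt (sw (k + 1)) p) :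
    OccursAt (sw k) (p + (sw (k + 1)).length) ∧
      ∃ r, p = r + (sw k).length ∧ OccursAt (sw k) r := by
  induction k generalizing p with
  | zero =>
    have hs : sw (0 + 1) = [true] := rfl
    have hs' : sw 0 = [false] := rfl
    rw [hs, occursAt_cons] at h
    simp only [hs, hs', occursAt_cons, occursAt_nil, and_true, List.length_singleton]
    obtain ⟨q, rfl, -⟩ := exists_cut_of_true h.1
    exact ⟨fw_succ_of_true h.1, cut q, rfl, fw_cut q⟩
  | succ k ih =>
    rcases Nat.even_or_odd k with hk | hk
    · have hσ := fibMorph_sw_of_even hk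
      have hs := sw_succ_of_odd (k := k + 1) (by grind)
      have hp : fw p = false := by
        obtain ⟨x, w, hw⟩ : ∃ x w, sw (k + 1) = x :: w := ⟨_, _, rfl⟩
        rw [hs, hw] at h
        cases x <;> rw [fibMorph, List.cons_append, occursAt_cons] at h <;> exact h.1
      obtain ⟨q, rfl⟩ := exists_cut_of_false hp
      rw [hs, occursAt_fibMorph_iff] at h
      obtain ⟨hr, r, rfl, hl⟩ := ih q h
      have hr' := (occursAt_fibMorph_iff _ _).2 hr
      have hl' := (occursAt_fibMorph_iff _ _).2 hl
      rw [hσ, List.cons_append, occursAt_cons, occursAt_append] at hr' hl'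
      rw [cut_add_length h] at hr'
      refine ⟨?_, cut r + 1, ?_, hl'.2.1⟩
      · rw [hs, List.length_append]
        exact hr'.2.1
      · rw [cut_add_length hl, hσ, List.length_cons]; omega
    · have hs := sw_succ_of_odd hk
      have hσ := fibMorph_sw_of_even (k := k + 1) (by grind)
      obtain ⟨g, hg⟩ := exists_sw_eq_concat_of_even (k := k + 1) (by grind)
      have hp : fw p = true := by
        obtain ⟨g', -, hg'⟩ := (sw_succ_eq_of_parity (k + 1)).1 (by grind)
        rw [hg', occursAt_cons] at h
        exact h.1
      obtain ⟨q, rfl, -⟩ := exists_cut_of_true hp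
      have hσq : OccursAt (fibMorph (sw (k + 1))) (cut q) := by
        rw [hσ, occursAt_cons]; exact ⟨fw_cut q, h⟩
      have hq : OccursAt (sw (k + 1)) q := by
        rw [← occursAt_fibMorph_iff, occursAt_append]
        refine ⟨hσq, ?_⟩
        have hg' : fibMorph (sw (k + 1)) = (fibMorph g ++ [false]) ++ [true] := by
          rw [hg, fibMorph_append]; simp [fibMorph]
        rw [hg', occursAt_append, occursAt_cons] at hσq
        rw [occursAt_cons, hg', List.length_append, List.length_singleton, ← add_assoc]
        exact ⟨fw_succ_of_true hσq.2.1, occursAt_nil _⟩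
      obtain ⟨hr, r, rfl, hl⟩ := ih q hq
      have hr' := (occursAt_fibMorph_iff _ _).2 hr
      have hl' := (occursAt_fibMorph_iff _ _).2 hl
      rw [← hs] at hr' hl'
      refine ⟨?_, cut r, ?_, hl'⟩
      · rw [cut_add_length hq, hσ, List.length_cons] at hr'
        convert hr' using 1
        omega
      · rw [cut_add_length hl, hs, List.length_append, List.length_singleton, add_assoc]

/-- if `ω ∈ T2.1`, i.e. `ω` is a factor with `f_k < n < f_{k+1}`
(`n = |ω|`) and `sk(ω) = s_k`, then in the kernel decomposition `ω = μ₁ s_k μ₂`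
there is `0 ≤ i ≤ n - f_k` with `μ₁` the suffix of `s_{k-1}` of length `i` and
`μ₂` the prefix of `s_{k-1}` of length `n - f_k - i`. -/
theorem stmt12 (k : ℕ) (ω : List Bool) (hfac : IsFactor ω)
    (h1 : Nat.fib (k+2) < ω.length) (h2 : ω.length < Nat.fib (k+3))
    (hker : IsKernelOf (sw (k+1)) ω) :
    ∀ μ₁ μ₂ : List Bool, ω = μ₁ ++ sw (k+1) ++ μ₂ →
      ∃ i : ℕ, i ≤ ω.length - Nat.fib (k+2) ∧
        μ₁ = (sw k).drop ((sw k).length - i) ∧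
        μ₂ = (sw k).take (ω.length - Nat.fib (k+2) - i) := by
  rintro μ₁ μ₂ rfl
  obtain ⟨p, hp⟩ := hfac
  rw [occursAt_append, occursAt_append] at hp
  obtain ⟨⟨hμ₁, hs⟩, hμ₂⟩ := hp
  obtain ⟨hr, r, hpr, hl⟩ := occursAt_sw_neighbours k _ hs
  have hlen : (sw (k + 1)).length = Nat.fib (k + 2) := length_sw (k + 1)
  have hlen' := length_sw k
  have hfib : Nat.fib (k + 3) = Nat.fib (k + 1) + Nat.fib (k + 2) := Nat.fib_add_two
  simp only [List.length_append] at h1 h2 hμ₂ ⊢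
  rw [← add_assoc] at hμ₂
  refine ⟨μ₁.length, by omega, ?_, ?_⟩
  · exact List.suffix_iff_eq_drop.1 (hμ₁.suffix_of_length_le hl hpr (by omega))
  · rw [show μ₁.length + (sw (k + 1)).length + μ₂.length - Nat.fib (k + 2) - μ₁.length
      = μ₂.length by omega]
    exact List.prefix_iff_eq_take.1 (hμ₂.prefix_of_length_le hr (by omega))
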